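/- Assume (A1)–(A8), let P : X → X* be a penalty operator for K, let ε > 0, and let Xʰ be a finite-dimensional linear subspace of X. Then there exists a unique element uʰ_ε ∈ Xʰ such that ⟨A uʰ_ε, vʰ − uʰ_ε⟩ + (1/ε) ⟨P uʰ_ε, vʰ − uʰ_ε⟩ + φ(γ_φ uʰ_ε, γ_φ vʰ) − φ(γ_φ uʰ_ε, γ_φ uʰ_ε) + j⁰(γ_j uʰ_ε; γ_j vʰ − γ_j uʰ_ε) ≥ ⟨f, vʰ − uʰ_ε⟩ for all vʰ ∈ Xʰ. -/

import Mathlib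

open Filter Topology Bornology

/-- The generalized (Clarke) directional derivative of `ψ` at `x` in the direction `v`:
`ψ⁰(x; v) = limsup_{y → x, t ↓ 0} (ψ(y + t v) − ψ(y))/t`. -/
noncomputable def clarkeDeriv {Y : Type*} [NormedAddCommGroup Y] [NormedSpace ℝ Y]
    (ψ : Y → ℝ) (x v : Y) : ℝ :=
  Filter.limsup (fun p : Y × ℝ => (ψ (p.1 + p.2 • v) - ψ p.1) / p.2)
    ((𝓝 x) ×ˢ (𝓝[>] (0 : ℝ)))

/-- The generalized (Clarke) subdifferential:
`∂ψ(x) = {ζ ∈ Y* : ψ⁰(x; v) ≥ ⟨ζ, v⟩ for all v ∈ Y}`. -/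
def clarkeSubdiff {Y : Type*} [NormedAddCommGroup Y] [NormedSpace ℝ Y]
    (ψ : Y → ℝ) (x : Y) : Set (Y →L[ℝ] ℝ) :=
  {ζ | ∀ v : Y, ζ v ≤ clarkeDeriv ψ x v}

/-- Weak convergence of a sequence in a normed space: `⟨g, uₙ⟩ → ⟨g, u⟩` for all `g ∈ Y*`. -/
def WeakTendsto {Y : Type*} [NormedAddCommGroup Y] [NormedSpace ℝ Y]
    (u : ℕ → Y) (w : Y) : Prop :=
  ∀ g : Y →L[ℝ] ℝ, Tendsto (fun n => g (u n)) atTop (𝓝 (g w))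

/-- An operator `A : Y → Y*` is bounded if it maps bounded sets to bounded sets. -/
def BoundedOperator {Y : Type*} [NormedAddCommGroup Y] [NormedSpace ℝ Y]
    (A : Y → Y →L[ℝ] ℝ) : Prop :=
  ∀ s : Set Y, IsBounded s → IsBounded (A '' s)

/-- `A : Y → Y*` is pseudomonotone: it is bounded, and whenever `uₙ ⇀ u` weakly and
`limsupₙ ⟨A uₙ, uₙ − u⟩ ≤ 0`, one has
`⟨A u, u − v⟩ ≤ liminfₙ ⟨A uₙ, uₙ − v⟩` for all `v`. -/
def Pseudomonotone {Y : Type*} [NormedAddCommGroup Y] [NormedSpace ℝ Y]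
    (A : Y → Y →L[ℝ] ℝ) : Prop :=
  BoundedOperator A ∧
  ∀ (u : ℕ → Y) (w : Y), WeakTendsto u w →
    Filter.limsup (fun n => A (u n) (u n - w)) atTop ≤ 0 →
    ∀ v : Y, A w (w - v) ≤ Filter.liminf (fun n => A (u n) (u n - v)) atTop

/-- `P : Y → Y*` is a penalty operator for the set `K`: `P` is bounded, demicontinuous,
monotone, and `Ker(P) = K`. -/
def IsPenaltyOperator {Y : Type*} [NormedAddCommGroup Y] [NormedSpace ℝ Y]
    (P : Y → Y →L[ℝ] ℝ) (K : Set Y) : Prop :=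
  BoundedOperator P ∧
  (∀ (u : ℕ → Y) (w : Y), Tendsto u atTop (𝓝 w) →
    ∀ v : Y, Tendsto (fun n => P (u n) v) atTop (𝓝 (P w v))) ∧
  (∀ v₁ v₂ : Y, 0 ≤ (P v₁ - P v₂) (v₁ - v₂)) ∧
  {v : Y | P v = 0} = K

/-- A real normed space is reflexive if the canonical embedding into the double dual
is surjective. -/
def IsReflexive (Y : Type*) [NormedAddCommGroup Y] [NormedSpace ℝ Y] : Prop :=
  Function.Surjective (NormedSpace.inclusionInDoubleDual ℝ Y)

/-- A square real matrix whose symmetric part has nonpositive entries admits a probability vector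
`w` with `M w ≤ 0`. -/
theorem exists_mem_stdSimplex_mulVec_nonpos {ι : Type*} [Fintype ι] [Nonempty ι]
    (M : Matrix ι ι ℝ) (hM : ∀ i k, M i k + M k i ≤ 0) :
    ∃ w ∈ stdSimplex ℝ ι, ∀ i, M.mulVec w i ≤ 0 := by
  classical
  by_contra! hcon
  have hconv : Convex ℝ (M.mulVecLin '' stdSimplex ℝ ι) :=
    (convex_stdSimplex ℝ ι).linear_image _
  have hcomp : IsCompact (M.mulVecLin '' stdSimplex ℝ ι) :=
    (isCompact_stdSimplex ℝ ι).image M.mulVecLin.continuous_of_finiteDimensional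
  have hdisj : Disjoint (M.mulVecLin '' stdSimplex ℝ ι) (Set.Iic 0) := by
    rw [Set.disjoint_left]
    rintro _ ⟨w, hw, rfl⟩ hle
    obtain ⟨i, hi⟩ := hcon w hw
    exact absurd (hle i) (not_le.2 hi)
  obtain ⟨g, a, b, hga, hab, hgb⟩ :=
    geometric_hahn_banach_compact_closed hconv hcomp (convex_Iic 0) isClosed_Iic hdisj
  have hb : b < 0 := by simpa using hgb 0 (by simp)
  have hg (x : ι → ℝ) : g x = ∑ i, x i * g (Pi.single i 1) := by
    conv_lhs => rw [pi_eq_sum_univ' x]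
    simp only [map_sum, map_smul, smul_eq_mul]
  have hsign (i : ι) : 0 ≤ -g (Pi.single i 1) := by
    by_contra! h
    have hpos : 0 < g (Pi.single i 1) := by linarith
    have hmem : (b / g (Pi.single i 1)) • (Pi.single i 1 : ι → ℝ) ∈ Set.Iic (0 : ι → ℝ) := by
      intro k
      have : b / g (Pi.single i 1) ≤ 0 := (div_neg_of_neg_of_pos hb hpos).le
      by_cases hk : k = i
      · subst hk; simpa using this
      · simp [hk]
    have := hgb _ hmem
    rw [map_smul, smul_eq_mul, div_mul_cancel₀ _ hpos.ne'] at this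
    exact lt_irrefl _ this
  have hgneg (w : ι → ℝ) (hw : w ∈ stdSimplex ℝ ι) : g (M.mulVec w) < 0 :=
    ((hga _ ⟨w, hw, rfl⟩).trans hab).trans hb
  set μ : ι → ℝ := fun i => -g (Pi.single i 1) with hμ
  have hsum : 0 < ∑ i, μ i := by
    refine (Finset.sum_nonneg fun i _ => hsign i).lt_of_ne' fun h0 => ?_
    have hz := (Finset.sum_eq_zero_iff_of_nonneg fun i _ => hsign i).1 h0
    have i₀ := Classical.arbitrary ι
    have := hgneg _ (single_mem_stdSimplex ℝ i₀)
    rw [hg] at this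
    refine this.ne (Finset.sum_eq_zero fun i hi => ?_)
    have := hz i hi
    simp only [neg_eq_zero] at this
    simp [this]
  have hw : (fun i => (∑ i, μ i)⁻¹ * μ i) ∈ stdSimplex ℝ ι :=
    ⟨fun i => mul_nonneg (inv_nonneg.2 hsum.le) (hsign i), by
      rw [← Finset.mul_sum, inv_mul_cancel₀ hsum.ne']⟩
  have hlt := hgneg _ hw
  have hquad : ∑ i, ∑ k, μ i * M i k * μ k ≤ 0 := by
    have hswap : ∑ i, ∑ k, μ i * M i k * μ k = ∑ i, ∑ k, μ i * M k i * μ k := by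
      rw [Finset.sum_comm]
      exact Finset.sum_congr rfl fun i _ => Finset.sum_congr rfl fun k _ => by ring
    have : ∑ i, ∑ k, μ i * M i k * μ k + ∑ i, ∑ k, μ i * M k i * μ k ≤ 0 := by
      simp only [← Finset.sum_add_distrib]
      refine Finset.sum_nonpos fun i _ => Finset.sum_nonpos fun k _ => ?_
      have := mul_nonneg (hsign i) (hsign k)
      have := mul_nonpos_of_nonneg_of_nonpos this (hM i k)
      simp only [hμ] at this ⊢
      linarith
    linarith
  have hval : g (M.mulVec fun i => (∑ i, μ i)⁻¹ * μ i)
      = -((∑ i, μ i)⁻¹ * ∑ i, ∑ k, μ i * M i k * μ k) := by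
    rw [hg, Finset.mul_sum, ← Finset.sum_neg_distrib]
    refine Finset.sum_congr rfl fun i _ => ?_
    simp only [Matrix.mulVec, dotProduct]
    rw [Finset.sum_mul, Finset.mul_sum, ← Finset.sum_neg_distrib]
    refine Finset.sum_congr rfl fun k _ => ?_
    have : g (Pi.single i 1) = -μ i := by simp [hμ]
    rw [this]
    ring
  rw [hval] at hlt
  have := mul_nonpos_of_nonneg_of_nonpos (inv_nonneg.2 hsum.le) hquad
  linarith

/-- A convex function on a finite-dimensional space that vanishes at the origin is bounded below
by a multiple of `-‖x‖` away from the unit ball. -/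
theorem ConvexOn.exists_neg_mul_norm_le {E : Type*} [NormedAddCommGroup E] [NormedSpace ℝ E]
    [FiniteDimensional ℝ E] {h : E → ℝ} (hh : ConvexOn ℝ Set.univ h) (h0 : h 0 = 0) :
    ∃ C, ∀ x, 1 ≤ ‖x‖ → -(C * ‖x‖) ≤ h x := by
  obtain ⟨C, hC⟩ := (isCompact_closedBall (0 : E) 1).exists_bound_of_continuousOn
    hh.locallyLipschitz.continuous.continuousOn
  refine ⟨C, fun x hx => ?_⟩
  have hpos : 0 < ‖x‖ := by linarith
  have hy : h (-(‖x‖⁻¹ • x)) ≤ C := (le_abs_self _).trans (hC _ (by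
    simp [norm_smul, inv_mul_cancel₀ hpos.ne']))
  have hden : 0 < 1 + ‖x‖ := by linarith
  have hc := hh.2 (Set.mem_univ x) (Set.mem_univ (-(‖x‖⁻¹ • x)))
    (show 0 ≤ 1 / (1 + ‖x‖) by positivity) (show 0 ≤ ‖x‖ / (1 + ‖x‖) by positivity)
    (by field_simp)
  have hz : (1 / (1 + ‖x‖)) • x + (‖x‖ / (1 + ‖x‖)) • -(‖x‖⁻¹ • x) = 0 := by
    rw [smul_neg, smul_smul, ← sub_eq_add_neg, ← sub_smul]
    have : 1 / (1 + ‖x‖) - ‖x‖ / (1 + ‖x‖) * ‖x‖⁻¹ = 0 := by field_simp; simp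
    rw [this, zero_smul]
  rw [hz, h0, smul_eq_mul, smul_eq_mul] at hc
  have : 0 ≤ h x + ‖x‖ * h (-(‖x‖⁻¹ • x)) := by
    have := mul_nonneg hden.le hc
    rwa [mul_add, ← mul_assoc, ← mul_assoc, mul_div_cancel₀ _ hden.ne',
      mul_div_cancel₀ _ hden.ne', one_mul] at this
  nlinarith

/-- A strongly monotone equilibrium problem on a finite-dimensional space, with a bifunction that
is convex in the second and upper hemicontinuous in the first argument, is uniquely solvable. -/
theorem existsUnique_equilibrium {E : Type*} [NormedAddCommGroup E] [NormedSpace ℝ E]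
    [FiniteDimensional ℝ E] (G : E → E → ℝ) (hdiag : ∀ u, G u u = 0)
    (hconv : ∀ u, ConvexOn ℝ Set.univ (G u)) {m : ℝ} (hm : 0 < m)
    (hmono : ∀ u v, G u v + G v u ≤ -(m * ‖u - v‖ ^ 2))
    (hclosed : ∀ v, IsClosed {u | 0 ≤ G u v}) :
    ∃! u, ∀ v, 0 ≤ G u v := by
  set H : E → E → ℝ := fun v u => G v u + m / 2 * ‖u - v‖ ^ 2 with hH
  have hHconv (v : E) : ConvexOn ℝ Set.univ (H v) := by
    refine (hconv v).add (ConvexOn.smul (c := m / 2) (by positivity) ?_)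
    have h1 : ConvexOn ℝ Set.univ fun u : E => ‖u - v‖ := by
      simpa [dist_eq_norm] using convexOn_univ_dist (E := E) v
    exact h1.pow (fun _ _ => norm_nonneg _) 2
  have hHmono (u v : E) : H u v + H v u ≤ 0 := by
    have := hmono u v
    simp only [hH]
    rw [norm_sub_rev v u]
    linarith
  have hHcl (v : E) : IsClosed {u | H v u ≤ 0} :=
    isClosed_le (hHconv v).locallyLipschitz.continuous continuous_const
  have hcompact : IsCompact {u | H 0 u ≤ 0} := by
    obtain ⟨C, hC⟩ := (hconv 0).exists_neg_mul_norm_le (hdiag 0)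
    refine Metric.isCompact_of_isClosed_isBounded (hHcl 0)
      (isBounded_iff_forall_norm_le.2 ⟨max 1 (2 * C / m), fun u hu => ?_⟩)
    by_contra! hlt
    obtain ⟨h1, h2⟩ := max_lt_iff.1 hlt
    have h3 := hC u h1.le
    simp only [hH, sub_zero, Set.mem_ofPred_eq] at hu
    rw [div_lt_iff₀ hm] at h2
    nlinarith
  obtain ⟨u, -, hu⟩ := hcompact.inter_iInter_nonempty (fun v => {u | H v u ≤ 0}) hHcl (by
    classical
    intro s
    have : Nonempty ↥(insert (0 : E) s) := ⟨⟨0, by simp⟩⟩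
    obtain ⟨w, hw, hle⟩ := exists_mem_stdSimplex_mulVec_nonpos
      (Matrix.of fun i k : ↥(insert (0 : E) s) => H i k) (fun i k => hHmono i k)
    have key (i : ↥(insert (0 : E) s)) : H i (∑ k, w k • (k : E)) ≤ 0 := by
      refine ((hHconv i).map_sum_le (fun k _ => hw.1 k) hw.2 (fun _ _ => Set.mem_univ _)).trans ?_
      refine le_trans (le_of_eq ?_) (hle i)
      simp [Matrix.mulVec, dotProduct, mul_comm]
    refine ⟨∑ k, w k • (k : E), key ⟨0, by simp⟩, ?_⟩
    simp only [Set.mem_iInter]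
    exact fun v hv => key ⟨v, by simp [hv]⟩)
  have hminty (v : E) : G v u ≤ 0 := by
    have : H v u ≤ 0 := Set.mem_iInter.1 hu v
    simp only [hH] at this
    have : 0 ≤ m / 2 * ‖u - v‖ ^ 2 := by positivity
    linarith
  have hsol (v : E) : 0 ≤ G u v := by
    have htend : Tendsto (fun t : ℝ => (1 - t) • u + t • v) (𝓝[>] 0) (𝓝 u) := by
      have : Continuous fun t : ℝ => (1 - t) • u + t • v := by fun_prop
      simpa using (this.tendsto 0).mono_left nhdsWithin_le_nhds
    refine (hclosed v).mem_of_tendsto htend ?_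
    filter_upwards [Ioo_mem_nhdsGT (zero_lt_one (α := ℝ))] with t ht
    set z := (1 - t) • u + t • v with hz
    have hc := (hconv z).2 (Set.mem_univ u) (Set.mem_univ v)
      (show 0 ≤ 1 - t by linarith [ht.2]) ht.1.le (by ring)
    rw [← hz, hdiag, smul_eq_mul, smul_eq_mul] at hc
    have h1 : (1 - t) * G z u ≤ 0 :=
      mul_nonpos_of_nonneg_of_nonpos (by linarith [ht.2]) (hminty z)
    exact nonneg_of_mul_nonneg_right (by linarith) ht.1
  refine ⟨u, hsol, fun u' hu' => ?_⟩
  have h1 := hmono u' u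
  have h2 := hu' u
  have h3 := hsol u'
  have h4 : ‖u' - u‖ ^ 2 ≤ 0 := by
    by_contra! h
    have := mul_pos hm h
    linarith
  exact sub_eq_zero.1 (norm_eq_zero.1 (pow_eq_zero_iff two_ne_zero |>.1
    (h4.antisymm (sq_nonneg _))))

section ClarkeDerivative

variable {Y : Type*} [NormedAddCommGroup Y] [NormedSpace ℝ Y] {ψ : Y → ℝ}

theorem tendsto_add_smul_clarke (x v : Y) :
    Tendsto (fun p : Y × ℝ => p.1 + p.2 • v) (𝓝 x ×ˢ 𝓝[>] (0 : ℝ)) (𝓝 x) := by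
  have hc : Continuous fun p : Y × ℝ => p.1 + p.2 • v := by fun_prop
  have := hc.tendsto (x, 0)
  rw [nhds_prod_eq] at this
  simpa using this.mono_left (prod_mono le_rfl nhdsWithin_le_nhds)

/-- A Lipschitz bound near `x` bounds the difference quotients defining `clarkeDeriv ψ x v`. -/
theorem eventually_abs_quotient_le {x : Y} {L : NNReal} {s : Set Y} (hs : s ∈ 𝓝 x)
    (hL : LipschitzOnWith L ψ s) (v : Y) :
    ∀ᶠ p : Y × ℝ in 𝓝 x ×ˢ 𝓝[>] (0 : ℝ),
      |(ψ (p.1 + p.2 • v) - ψ p.1) / p.2| ≤ L * ‖v‖ := by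
  have h1 : ∀ᶠ p : Y × ℝ in 𝓝 x ×ˢ 𝓝[>] (0 : ℝ), p.1 ∈ s := tendsto_fst.eventually hs
  have h2 : ∀ᶠ p : Y × ℝ in 𝓝 x ×ˢ 𝓝[>] (0 : ℝ), 0 < p.2 :=
    tendsto_snd.eventually self_mem_nhdsWithin
  have h3 : ∀ᶠ p : Y × ℝ in 𝓝 x ×ˢ 𝓝[>] (0 : ℝ), p.1 + p.2 • v ∈ s :=
    (tendsto_add_smul_clarke x v).eventually hs
  filter_upwards [h1, h2, h3] with p hp1 hp2 hp3
  rw [abs_div, abs_of_pos hp2, div_le_iff₀ hp2]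
  have := hL.dist_le_mul _ hp3 _ hp1
  rw [Real.dist_eq, dist_eq_norm, add_sub_cancel_left, norm_smul, Real.norm_of_nonneg hp2.le] at this
  linarith

theorem isBoundedUnder_quotient (hψ : LocallyLipschitz ψ) (x v : Y) :
    IsBoundedUnder (· ≤ ·) (𝓝 x ×ˢ 𝓝[>] (0 : ℝ))
      fun p : Y × ℝ => (ψ (p.1 + p.2 • v) - ψ p.1) / p.2 := by
  obtain ⟨L, s, hs, hL⟩ := hψ x
  exact ⟨L * ‖v‖, (eventually_abs_quotient_le hs hL v).mono fun p hp => (le_abs_self _).trans hp⟩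

theorem isCoboundedUnder_quotient (hψ : LocallyLipschitz ψ) (x v : Y) :
    IsCoboundedUnder (· ≤ ·) (𝓝 x ×ˢ 𝓝[>] (0 : ℝ))
      fun p : Y × ℝ => (ψ (p.1 + p.2 • v) - ψ p.1) / p.2 := by
  obtain ⟨L, s, hs, hL⟩ := hψ x
  exact IsBoundedUnder.isCoboundedUnder_le
    ⟨-(L * ‖v‖), (eventually_abs_quotient_le hs hL v).mono fun p hp => (abs_le.1 hp).1⟩

theorem eventually_quotient_lt (hψ : LocallyLipschitz ψ) {x v : Y} {c : ℝ}
    (h : clarkeDeriv ψ x v < c) :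
    ∀ᶠ p : Y × ℝ in 𝓝 x ×ˢ 𝓝[>] (0 : ℝ), (ψ (p.1 + p.2 • v) - ψ p.1) / p.2 < c :=
  eventually_lt_of_limsup_lt h (isBoundedUnder_quotient hψ x v)

theorem clarkeDeriv_le (hψ : LocallyLipschitz ψ) {x v : Y} {c : ℝ}
    (h : ∀ᶠ p : Y × ℝ in 𝓝 x ×ˢ 𝓝[>] (0 : ℝ), (ψ (p.1 + p.2 • v) - ψ p.1) / p.2 ≤ c) :
    clarkeDeriv ψ x v ≤ c :=
  limsup_le_of_le (isCoboundedUnder_quotient hψ x v) h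

@[simp]
theorem clarkeDeriv_zero (ψ : Y → ℝ) (x : Y) : clarkeDeriv ψ x 0 = 0 := by
  simp [clarkeDeriv]

theorem clarkeDeriv_add_le (hψ : LocallyLipschitz ψ) (x v w : Y) :
    clarkeDeriv ψ x (v + w) ≤ clarkeDeriv ψ x v + clarkeDeriv ψ x w := by
  refine le_of_forall_pos_le_add fun η hη => clarkeDeriv_le hψ ?_
  have hv := eventually_quotient_lt hψ
    (show clarkeDeriv ψ x v < clarkeDeriv ψ x v + η / 2 by linarith)
  have hw := eventually_quotient_lt hψ
    (show clarkeDeriv ψ x w < clarkeDeriv ψ x w + η / 2 by linarith)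
  filter_upwards [hv, ((tendsto_add_smul_clarke x v).prodMk tendsto_snd).eventually hw]
    with p h1 h2
  have : (ψ (p.1 + p.2 • (v + w)) - ψ p.1) / p.2 = (ψ (p.1 + p.2 • v) - ψ p.1) / p.2
      + (ψ (p.1 + p.2 • v + p.2 • w) - ψ (p.1 + p.2 • v)) / p.2 := by
    rw [smul_add, ← add_assoc]
    ring
  rw [this]
  linarith

theorem clarkeDeriv_smul_le (hψ : LocallyLipschitz ψ) (x v : Y) {c : ℝ} (hc : 0 ≤ c) :
    clarkeDeriv ψ x (c • v) ≤ c * clarkeDeriv ψ x v := by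
  rcases hc.eq_or_lt with rfl | hc
  · simp
  have hlim : Tendsto (fun t : ℝ => c * t) (𝓝[>] 0) (𝓝[>] 0) := by
    refine tendsto_nhdsWithin_iff.2 ⟨?_, ?_⟩
    · simpa using ((continuous_const_mul c).tendsto 0).mono_left nhdsWithin_le_nhds
    · filter_upwards [self_mem_nhdsWithin] with t ht using mul_pos hc ht
  refine le_of_forall_pos_le_add fun η hη => clarkeDeriv_le hψ ?_
  have hv := eventually_quotient_lt hψ
    (show clarkeDeriv ψ x v < clarkeDeriv ψ x v + η / c by linarith [div_pos hη hc])
  filter_upwards [(tendsto_fst.prodMk (hlim.comp tendsto_snd)).eventually hv] with p hp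
  have : (ψ (p.1 + p.2 • c • v) - ψ p.1) / p.2
      = c * ((ψ (p.1 + (c * p.2) • v) - ψ p.1) / (c * p.2)) := by
    rw [smul_smul, mul_comm p.2 c, mul_div_assoc', mul_div_mul_left _ _ hc.ne']
  rw [this]
  calc _ ≤ c * (clarkeDeriv ψ x v + η / c) := mul_le_mul_of_nonneg_left hp.le hc.le
    _ = _ := by field_simp

theorem convexOn_clarkeDeriv (hψ : LocallyLipschitz ψ) (x : Y) :
    ConvexOn ℝ Set.univ (clarkeDeriv ψ x) :=
  ⟨convex_univ, fun v _ w _ _ _ ha hb _ => (clarkeDeriv_add_le hψ x _ _).trans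
    (add_le_add (clarkeDeriv_smul_le hψ x v ha) (clarkeDeriv_smul_le hψ x w hb))⟩

/-- The Clarke directional derivative of a locally Lipschitz function is jointly upper
semicontinuous in the point and the direction. -/
theorem upperSemicontinuous_clarkeDeriv (hψ : LocallyLipschitz ψ) :
    UpperSemicontinuous fun q : Y × Y => clarkeDeriv ψ q.1 q.2 := by
  rintro ⟨x, v⟩ c hc
  obtain ⟨d, hd, hdc⟩ := exists_between hc
  obtain ⟨L, s, hs, hL⟩ := hψ x
  have hbase : ∀ᶠ x' in 𝓝 x, clarkeDeriv ψ x' v ≤ d := by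
    obtain ⟨p, hp, r, hr, hpr⟩ := eventually_prod_iff.1 (eventually_quotient_lt hψ hd)
    filter_upwards [eventually_eventually_nhds.2 hp] with x' hx'
    exact clarkeDeriv_le hψ (eventually_prod_iff.2 ⟨p, hx', r, hr, fun h _ h' => (hpr h h').le⟩)
  have hincr : ∀ᶠ x' in 𝓝 x, ∀ w, clarkeDeriv ψ x' w ≤ L * ‖w‖ := by
    filter_upwards [eventually_mem_nhds_iff.2 hs] with x' hx' w
    exact clarkeDeriv_le hψ
      ((eventually_abs_quotient_le hx' hL w).mono fun p hp => (le_abs_self _).trans hp)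
  have hsmall : ∀ᶠ w in 𝓝 v, (L : ℝ) * ‖w - v‖ < c - d := by
    have : Continuous fun w : Y => (L : ℝ) * ‖w - v‖ := by fun_prop
    exact (this.tendsto v).eventually_lt_const (by simpa using hdc)
  rw [nhds_prod_eq]
  filter_upwards [(hbase.and hincr).prod_mk hsmall] with q hq
  have h := clarkeDeriv_add_le hψ q.1 v (q.2 - v)
  rw [add_sub_cancel] at h
  have := hq.1.2 (q.2 - v)
  show clarkeDeriv ψ q.1 q.2 < c
  linarith [hq.1.1, hq.2]

end ClarkeDerivative

/-- A pseudomonotone operator is upper semicontinuous along the diagonal pairing. -/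
theorem Pseudomonotone.upperSemicontinuous {X : Type*} [NormedAddCommGroup X] [NormedSpace ℝ X]
    {A : X → X →L[ℝ] ℝ} (hA : Pseudomonotone A) (v : X) :
    UpperSemicontinuous fun u => A u (v - u) := by
  refine upperSemicontinuous_iff_isClosed_preimage.2 fun c => IsSeqClosed.isClosed ?_
  intro x u hx hxu
  obtain ⟨C, hC⟩ := isBounded_iff_forall_norm_le.1
    (hA.1 _ (Metric.isBounded_range_of_tendsto x hxu))
  have hb (n : ℕ) (y : X) : |A (x n) y| ≤ C * ‖y‖ :=
    (A (x n)).le_of_opNorm_le (hC _ ⟨_, ⟨n, rfl⟩, rfl⟩) y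
  have hz : Tendsto (fun n => A (x n) (x n - u)) atTop (𝓝 0) := by
    refine squeeze_zero_norm (fun n => hb n _) ?_
    simpa using (tendsto_iff_norm_sub_tendsto_zero.1 hxu).const_mul C
  have h := hA.2 x u (fun g => (g.continuous.tendsto u).comp hxu) hz.limsup_eq.le v
  have hle : liminf (fun n => A (x n) (x n - v)) atTop ≤ -c := by
    refine liminf_le_of_frequently_le (Frequently.of_forall fun n => ?_) ?_
    · have : c ≤ A (x n) (v - x n) := hx n
      rw [← neg_sub, map_neg]
      linarith
    · have hn : Tendsto (fun n => -(C * ‖x n - v‖)) atTop (𝓝 (-(C * ‖u - v‖))) :=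
        ((hxu.sub_const v).norm.const_mul C).neg
      exact hn.isBoundedUnder_ge.mono_ge (Eventually.of_forall fun n => (abs_le.1 (hb n _)).1)
  show c ≤ A u (v - u)
  rw [← neg_sub, map_neg]
  linarith

/-- A bounded demicontinuous operator is upper semicontinuous along the diagonal pairing. -/
theorem BoundedOperator.upperSemicontinuous {X : Type*} [NormedAddCommGroup X] [NormedSpace ℝ X]
    {P : X → X →L[ℝ] ℝ} (hP : BoundedOperator P)
    (hdemi : ∀ (u : ℕ → X) (w : X), Tendsto u atTop (𝓝 w) →
      ∀ v : X, Tendsto (fun n => P (u n) v) atTop (𝓝 (P w v))) (v : X) :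
    UpperSemicontinuous fun u => P u (v - u) := by
  refine upperSemicontinuous_iff_isClosed_preimage.2 fun c => IsSeqClosed.isClosed ?_
  intro x u hx hxu
  obtain ⟨C, hC⟩ := isBounded_iff_forall_norm_le.1
    (hP _ (Metric.isBounded_range_of_tendsto x hxu))
  have hz : Tendsto (fun n => P (x n) (x n - u)) atTop (𝓝 0) := by
    refine squeeze_zero_norm
      (fun n => (P (x n)).le_of_opNorm_le (hC _ ⟨_, ⟨n, rfl⟩, rfl⟩) _) ?_
    simpa using (tendsto_iff_norm_sub_tendsto_zero.1 hxu).const_mul C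
  have h := (hdemi x u hxu (v - u)).sub hz
  rw [sub_zero] at h
  refine ge_of_tendsto h (Eventually.of_forall fun n => ?_)
  have hn : c ≤ P (x n) (v - x n) := hx n
  rwa [← map_sub, sub_sub_sub_cancel_right]

/-- A bifunction that is lower semicontinuous in its second argument and satisfies a four-point
Lipschitz condition is upper semicontinuous along the diagonal difference. -/
theorem upperSemicontinuous_diagonal_sub {Z : Type*} [NormedAddCommGroup Z] {φ : Z → Z → ℝ}
    (hlsc : ∀ z, LowerSemicontinuous (φ z)) {α : ℝ}
    (hφ : ∀ z₁ z₂ z₃ z₄ : Z,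
      φ z₁ z₄ - φ z₁ z₃ + φ z₂ z₃ - φ z₂ z₄ ≤ α * ‖z₁ - z₂‖ * ‖z₃ - z₄‖) (v : Z) :
    UpperSemicontinuous fun u => φ u v - φ u u := by
  intro u₀ c hc
  obtain ⟨d, hd, hdc⟩ := exists_between hc
  have h1 := hlsc u₀ u₀ (φ u₀ v - d) (by linarith)
  have h2 : ∀ᶠ u in 𝓝 u₀, α * ‖u - u₀‖ * ‖u - v‖ < c - d := by
    have : Continuous fun u : Z => α * ‖u - u₀‖ * ‖u - v‖ := by fun_prop
    exact (this.tendsto u₀).eventually_lt_const (by simpa using hdc)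
  filter_upwards [h1, h2] with u hu1 hu2
  linarith [hφ u u₀ u v]

/-- under (A1)–(A8), for a penalty operator `P` for `K`, a penalty
parameter `ε > 0` and a finite-dimensional subspace `Xʰ ⊆ X`, the discrete penalized
problem (Pʰ_ε) has a unique solution `uʰ_ε ∈ Xʰ`. -/
theorem penalized_discrete_exists_unique
    {X Xφ Xj : Type*}
    [NormedAddCommGroup X] [NormedSpace ℝ X] [CompleteSpace X]
    [NormedAddCommGroup Xφ] [NormedSpace ℝ Xφ] [CompleteSpace Xφ]
    [NormedAddCommGroup Xj] [NormedSpace ℝ Xj] [CompleteSpace Xj]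
    -- (A1)
    (hrefl : IsReflexive X)
    (K : Set X) (hKne : K.Nonempty) (hKcl : IsClosed K) (hKcv : Convex ℝ K)
    -- (A2)
    (γφ : X →L[ℝ] Xφ) (cφ : ℝ) (hcφ : 0 < cφ) (hγφ : ∀ v : X, ‖γφ v‖ ≤ cφ * ‖v‖)
    -- (A3)
    (γj : X →L[ℝ] Xj) (cj : ℝ) (hcj : 0 < cj) (hγj : ∀ v : X, ‖γj v‖ ≤ cj * ‖v‖)
    -- (A4)
    (A : X → X →L[ℝ] ℝ) (hA : Pseudomonotone A)
    (mA : ℝ) (hmA : 0 < mA)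
    (hAsm : ∀ v₁ v₂ : X, mA * ‖v₁ - v₂‖ ^ 2 ≤ (A v₁ - A v₂) (v₁ - v₂))
    -- (A5)
    (φ : Xφ → Xφ → ℝ)
    (hφcv : ∀ z : Xφ, ConvexOn ℝ Set.univ (φ z))
    (hφlsc : ∀ z : Xφ, LowerSemicontinuous (φ z))
    (αφ : ℝ) (hαφ : 0 ≤ αφ)
    (hφ : ∀ z₁ z₂ z₃ z₄ : Xφ,
      φ z₁ z₄ - φ z₁ z₃ + φ z₂ z₃ - φ z₂ z₄ ≤ αφ * ‖z₁ - z₂‖ * ‖z₃ - z₄‖)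
    -- (A6)
    (j : Xj → ℝ) (hj : LocallyLipschitz j)
    (c₀ c₁ : ℝ) (hc₀ : 0 ≤ c₀) (hc₁ : 0 ≤ c₁)
    (hjsub : ∀ (z : Xj), ∀ ζ ∈ clarkeSubdiff j z, ‖ζ‖ ≤ c₀ + c₁ * ‖z‖)
    (αj : ℝ) (hαj : 0 ≤ αj)
    (hj2 : ∀ z₁ z₂ : Xj,
      clarkeDeriv j z₁ (z₂ - z₁) + clarkeDeriv j z₂ (z₁ - z₂) ≤ αj * ‖z₁ - z₂‖ ^ 2)
    -- (A7)
    (hsmall : αφ * cφ ^ 2 + αj * cj ^ 2 < mA)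
    -- (A8)
    (f : X →L[ℝ] ℝ)
    -- penalty operator, penalty parameter and finite-dimensional subspace
    (P : X → X →L[ℝ] ℝ) (hP : IsPenaltyOperator P K)
    (ε : ℝ) (hε : 0 < ε)
    (Xh : Submodule ℝ X) (hXh : FiniteDimensional ℝ Xh) :
    ∃! u : X, u ∈ Xh ∧ ∀ vh ∈ Xh,
      f (vh - u) ≤ A u (vh - u) + (1 / ε) * P u (vh - u)
        + (φ (γφ u) (γφ vh) - φ (γφ u) (γφ u))
        + clarkeDeriv j (γj u) (γj vh - γj u) := by
  obtain ⟨hPb, hPd, hPm, -⟩ := hP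
  set G : Xh → Xh → ℝ := fun u v => A u (v - u : X) + (1 / ε) * P u (v - u : X)
    + (φ (γφ u) (γφ v) - φ (γφ u) (γφ u)) + clarkeDeriv j (γj u) (γj v - γj u)
    - f (v - u : X) with hG
  have hlin (g : X →L[ℝ] ℝ) (u : X) : ConvexOn ℝ Set.univ fun v : Xh => g (v - u : X) := by
    refine ⟨convex_univ, fun v _ w _ a b _ _ hab => le_of_eq ?_⟩
    simp only [Submodule.coe_add, Submodule.coe_smul, map_sub, map_add, map_smul, smul_eq_mul]
    linear_combination g u * hab
  have hconv (u : Xh) : ConvexOn ℝ Set.univ (G u) := by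
    have h1 := hlin (A u + (1 / ε) • P u - f) u
    have h2 : ConvexOn ℝ Set.univ fun v : Xh => φ (γφ u) (γφ v) :=
      (hφcv (γφ u)).comp_linearMap (γφ.toLinearMap ∘ₗ Xh.subtype)
    have h3 : ConvexOn ℝ Set.univ fun v : Xh => clarkeDeriv j (γj u) (γj v - γj u) := by
      have := ((convexOn_clarkeDeriv hj (γj u)).translate_left (-γj u)).comp_linearMap
        (γj.toLinearMap ∘ₗ Xh.subtype)
      simpa [Function.comp_def, sub_eq_add_neg] using this
    refine (((h1.add h2).add h3).add_const (-φ (γφ u) (γφ u))).congr fun v _ => ?_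
    simp only [hG, Pi.add_apply, sub_apply, add_apply,
      smul_apply, smul_eq_mul]
    ring
  have hmono (u v : Xh) :
      G u v + G v u ≤ -((mA - (αφ * cφ ^ 2 + αj * cj ^ 2)) * ‖u - v‖ ^ 2) := by
    have hA' := hAsm u v
    have hP' := mul_nonneg (one_div_pos.2 hε).le (hPm u v)
    have hφ' := hφ (γφ u) (γφ v) (γφ u) (γφ v)
    have hj' := hj2 (γj u) (γj v)
    have hnφ : ‖γφ u - γφ v‖ ^ 2 ≤ cφ ^ 2 * ‖(u : X) - v‖ ^ 2 := by
      rw [← map_sub, ← mul_pow]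
      exact pow_le_pow_left₀ (norm_nonneg _) (hγφ _) 2
    have hnj : ‖γj u - γj v‖ ^ 2 ≤ cj ^ 2 * ‖(u : X) - v‖ ^ 2 := by
      rw [← map_sub, ← mul_pow]
      exact pow_le_pow_left₀ (norm_nonneg _) (hγj _) 2
    have hnφ' := mul_le_mul_of_nonneg_left hnφ hαφ
    have hnj' := mul_le_mul_of_nonneg_left hnj hαj
    have hn : ‖u - v‖ = ‖(u : X) - v‖ := rfl
    rw [hn]
    simp only [hG, sub_apply, map_sub] at hA' hP' ⊢
    nlinarith
  have hclosed (v : Xh) : IsClosed {u | 0 ≤ G u v} := by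
    have h1 : UpperSemicontinuous fun u : X => A u (v - u : X) := hA.upperSemicontinuous v
    have h2 : UpperSemicontinuous fun u : X => ((1 / ε) • P) u (v - u : X) := by
      refine BoundedOperator.upperSemicontinuous (fun s hs => ?_) (fun x u hx w => ?_) (v : X)
      · have := (hPb s hs).smul₀ (1 / ε)
        rwa [← Set.image_smul, Set.image_image] at this
      · exact (hPd x u hx w).const_mul _
    have h3 : UpperSemicontinuous fun u : X => φ (γφ u) (γφ v) - φ (γφ u) (γφ u) :=
      (upperSemicontinuous_diagonal_sub hφlsc hφ (γφ v)).comp γφ.continuous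
    have h4 : UpperSemicontinuous fun u : X => clarkeDeriv j (γj u) (γj v - γj u) :=
      UpperSemicontinuous.comp (g := fun u : X => (γj u, γj v - γj u))
        (upperSemicontinuous_clarkeDeriv hj) (by fun_prop)
    have h5 : UpperSemicontinuous fun u : X => -f (v - u : X) :=
      Continuous.upperSemicontinuous (by fun_prop)
    have h := ((((h1.add h2).add h3).add h4).add h5).comp
      (continuous_subtype_val : Continuous (Subtype.val : Xh → X))
    exact h.isClosed_preimage 0
  have hmem (u : Xh) : (∀ v, 0 ≤ G u v) ↔ ∀ vh ∈ Xh,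
      f (vh - u) ≤ A u (vh - u) + (1 / ε) * P u (vh - u)
        + (φ (γφ u) (γφ vh) - φ (γφ u) (γφ u))
        + clarkeDeriv j (γj u) (γj vh - γj u) := by
    simp only [hG, sub_nonneg, Subtype.forall]
  obtain ⟨u, hu, huniq⟩ := existsUnique_equilibrium G (fun u => by simp [hG]) hconv
    (sub_pos.2 hsmall) hmono hclosed
  refine ⟨u, ⟨u.2, (hmem u).1 hu⟩, fun w hw => ?_⟩
  exact congrArg Subtype.val (huniq ⟨w, hw.1⟩ ((hmem ⟨w, hw.1⟩).2 hw.2))
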